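/- arXiv:math/0201311 — 2 statements merged into one kernel-verified Lean document; each statement's English description precedes it below -/
import Mathlib

section
/- Let f be an odd positive integer. The natural ring map R⁺₁/fR⁺₁ → R₁/fR₁ is injective, and the norm map x ↦ x·x̄ from (R₁/fR₁)ˣ to (R⁺₁/fR⁺₁)ˣ is surjective: every unit of R⁺₁/fR⁺₁ is the norm of a unit of R₁/fR₁. -/
noncomputable section
open Complex Pointwise

/-- `√−2 = i·√2` -/
def sm2 : ℂ := Complex.I * Real.sqrt 2
/-- `√−D = i·√D` -/
def smD (D : ℕ) : ℂ := Complex.I * Real.sqrt D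
/-- `√(2D)` -/
def s2D (D : ℕ) : ℂ := (Real.sqrt (2 * D) : ℝ)
/-- `w = (√(2D) + √−2)/2` -/
def w (D : ℕ) : ℂ := (s2D D + sm2) / 2
/-- `𝒪 = ℤ[√−2]` -/
def OO : Subring ℂ := Subring.closure {sm2}
/-- `R_f = 𝒪 + f·w·𝒪 = ℤ[√−2, f·w]`, an order in `K`. -/
def Rf (D f : ℕ) : Subring ℂ := Subring.closure {sm2, (f : ℂ) * w D}
/-- `R⁺_f = ℤ[f·√(2D)]`, an order in `K⁺`. -/
def Rpf (D f : ℕ) : Subring ℂ := Subring.closure {(f : ℂ) * s2D D}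
/-- `S_f = ℤ[f·√−D]`, an order in `L`. -/
def Sf (D f : ℕ) : Subring ℂ := Subring.closure {(f : ℂ) * smD D}
/-- `K = ℚ(√−2, √−D)` -/
def Kf (D : ℕ) : IntermediateField ℚ ℂ := IntermediateField.adjoin ℚ {sm2, smD D}
/-- `K⁺ = ℚ(√(2D))`, the maximal real subfield of `K`. -/
def Kp (D : ℕ) : IntermediateField ℚ ℂ := IntermediateField.adjoin ℚ {s2D D}
/-- `L = ℚ(√−D)` -/
def Lf (D : ℕ) : IntermediateField ℚ ℂ := IntermediateField.adjoin ℚ {smD D}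

lemma conj_sm2 : (starRingEnd ℂ) sm2 = -sm2 := by
  simp [sm2]

lemma conj_s2D (D : ℕ) : (starRingEnd ℂ) (s2D D) = s2D D := by
  simp [s2D]

lemma conj_w (D : ℕ) : (starRingEnd ℂ) (w D) = w D - sm2 := by
  have h2 : (starRingEnd ℂ) (2 : ℂ) = 2 := by
    simp [Complex.ext_iff]
  rw [w, map_div₀, map_add, conj_s2D, conj_sm2, h2]
  ring

/-- `R_f` is stable under complex conjugation. -/
lemma conj_mem_Rf (D f : ℕ) : ∀ x ∈ Rf D f, (starRingEnd ℂ) x ∈ Rf D f := by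
  intro x hx
  induction hx using Subring.closure_induction with
  | mem y hy =>
      rcases hy with rfl | rfl
      · rw [conj_sm2]
        exact neg_mem (Subring.subset_closure (Or.inl rfl))
      · rw [map_mul, conj_w]
        have h1 : (f : ℂ) * w D ∈ Rf D f := Subring.subset_closure (Or.inr rfl)
        have h2 : sm2 ∈ Rf D f := Subring.subset_closure (Or.inl rfl)
        have h3 : (starRingEnd ℂ) (f : ℂ) = (f : ℂ) := by simp
        rw [h3, mul_sub]
        exact sub_mem h1 (mul_mem (natCast_mem _ f) h2)
  | one => simpa using one_mem (Rf D f)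
  | zero => simpa using zero_mem (Rf D f)
  | add x y hx hy ihx ihy => rw [map_add]; exact add_mem ihx ihy
  | neg x hx ihx => rw [map_neg]; exact neg_mem ihx
  | mul x y hx hy ihx ihy => rw [map_mul]; exact mul_mem ihx ihy

/-- Complex conjugation as a ring endomorphism of a conjugation-stable subring of `ℂ`. -/
def subringConj (R : Subring ℂ) (h : ∀ x ∈ R, (starRingEnd ℂ) x ∈ R) : R →+* R where
  toFun x := ⟨(starRingEnd ℂ) x, h x x.2⟩
  map_one' := Subtype.ext (by simp)
  map_mul' x y := Subtype.ext (by simp)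
  map_zero' := Subtype.ext (by simp)
  map_add' x y := Subtype.ext (by simp)

lemma s2D_eq (D : ℕ) : (s2D D : ℂ) = 2 * w D - sm2 := by
  unfold w; ring

/-- `R⁺_f ⊆ R_f`. -/
lemma Rpf_le_Rf (D f : ℕ) : Rpf D f ≤ Rf D f := by
  rw [Rpf, Subring.closure_le]
  intro y hy
  rcases hy with rfl
  have h1 : (f : ℂ) * w D ∈ Rf D f := Subring.subset_closure (Or.inr rfl)
  have h2 : sm2 ∈ Rf D f := Subring.subset_closure (Or.inl rfl)
  have heq : (f : ℂ) * s2D D = ((f : ℂ) * w D + (f : ℂ) * w D) - (f : ℂ) * sm2 := by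
    rw [s2D_eq]; ring
  rw [SetLike.mem_coe, heq]
  exact sub_mem (add_mem h1 h1) (mul_mem (natCast_mem _ f) h2)

lemma w_mem_R1 (D : ℕ) : w D ∈ Rf D 1 := by
  have := Subring.subset_closure (s := {sm2, ((1:ℕ) : ℂ) * w D}) (Or.inr rfl)
  simpa [Rf] using this

/-- `R_f ⊆ R₁`. -/
lemma Rf_le_R1 (D f : ℕ) : Rf D f ≤ Rf D 1 := by
  rw [Rf, Subring.closure_le]
  intro y hy
  rcases hy with rfl | rfl
  · exact Subring.subset_closure (Or.inl rfl)
  · exact mul_mem (natCast_mem _ f) (w_mem_R1 D)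

/-- `R⁺_f ⊆ R⁺₁`. -/
lemma Rpf_le_Rp1 (D f : ℕ) : Rpf D f ≤ Rpf D 1 := by
  rw [Rpf, Subring.closure_le]
  intro y hy
  rcases hy with rfl
  have h0 : ((1:ℕ) : ℂ) * s2D D ∈ Rpf D 1 := Subring.subset_closure rfl
  have h1 : s2D D ∈ Rpf D 1 := by simpa using h0
  rw [SetLike.mem_coe]
  exact mul_mem (natCast_mem _ f) h1

/-- The ideal `f·R` of a subring `R` of `ℂ`. -/
def fIdeal (R : Subring ℂ) (f : ℕ) : Ideal R := Ideal.span {(f : R)}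

/-- The ring homomorphism `R/fR → S/fS` induced by an inclusion `R ≤ S` of subrings of `ℂ`. -/
def quotIncl {R S : Subring ℂ} (h : R ≤ S) (f : ℕ) :
    R ⧸ fIdeal R f →+* S ⧸ fIdeal S f :=
  Ideal.quotientMap _ (Subring.inclusion h) (by
    rw [fIdeal, Ideal.span_le]
    intro x hx
    rcases Set.mem_singleton_iff.1 hx with rfl
    show Subring.inclusion h ((f : ℕ) : R) ∈ fIdeal S f
    rw [map_natCast]
    exact Ideal.subset_span rfl)

/-- Conjugation on `R/fR` induced by complex conjugation on a stable subring `R`. -/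
def quotConj (R : Subring ℂ) (hc : ∀ x ∈ R, (starRingEnd ℂ) x ∈ R) (f : ℕ) :
    R ⧸ fIdeal R f →+* R ⧸ fIdeal R f :=
  Ideal.quotientMap _ (subringConj R hc) (by
    rw [fIdeal, Ideal.span_le]
    intro x hx
    rcases Set.mem_singleton_iff.1 hx with rfl
    show subringConj R hc ((f : ℕ) : R) ∈ fIdeal R f
    rw [map_natCast]
    exact Ideal.subset_span rfl)

/-- In a finite field of odd characteristic, `x² + d·y²` with `d ≠ 0` takes every value. -/
lemma exists_sq_add_mul_sq_of_field {K : Type*} [Field K] [Finite K] (h2 : (2 : K) ≠ 0)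
    {d : K} (hd : d ≠ 0) (v : K) : ∃ a b : K, v = a ^ 2 + d * b ^ 2 := by
  have := Fintype.ofFinite K
  have hchar : ringChar K ≠ 2 := fun h ↦ h2 (by
    have := ringChar.Nat.cast_ringChar (R := K)
    rw [h] at this
    exact_mod_cast this)
  obtain ⟨a, b, hab⟩ := FiniteField.exists_root_sum_quadratic
    (Polynomial.degree_quadratic (b := 0) (c := -v) (one_ne_zero (α := K)))
    (Polynomial.degree_quadratic (b := 0) (c := 0) hd)
    (FiniteField.odd_card_of_char_ne_two hchar)
  simp only [Polynomial.eval_add, Polynomial.eval_mul, Polynomial.eval_C, Polynomial.eval_pow,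
    Polynomial.eval_X] at hab
  exact ⟨a, b, by linear_combination -hab⟩

/-- If `2` is invertible, then `1 + n` is a square for every nilpotent `n`. -/
lemma exists_sq_eq_one_add_of_isNilpotent {A : Type*} [CommRing A] (h2 : IsUnit (2 : A))
    {n : A} (hn : IsNilpotent n) : ∃ r : A, r ^ 2 = 1 + n := by
  obtain ⟨r, ⟨-, hr⟩, -⟩ := Polynomial.existsUnique_nilpotent_sub_and_aeval_eq_zero
    (P := (Polynomial.X ^ 2 - Polynomial.C (1 + n) : Polynomial A)) (x := (1 : A))
    (by simpa using hn.neg) (by simpa [one_add_one_eq_two] using h2)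
  exact ⟨r, by simpa [sub_eq_zero] using hr⟩

/-- In a finite commutative ring in which `2` and `d` are invertible, every unit is of the form
`x² + d·y²`. -/
lemma exists_sq_add_mul_sq_of_isUnit {A : Type*} [CommRing A] [Finite A] (h2 : IsUnit (2 : A))
    {d v : A} (hd : IsUnit d) (hv : IsUnit v) : ∃ a b : A, v = a ^ 2 + d * b ^ 2 := by
  have key (I : MaximalSpectrum A) : ∃ a b : A ⧸ I.asIdeal,
      Ideal.Quotient.mk I.asIdeal v = a ^ 2 + Ideal.Quotient.mk I.asIdeal d * b ^ 2 := by
    let _ := Ideal.Quotient.field I.asIdeal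
    have : Finite (A ⧸ I.asIdeal) := Finite.of_surjective _ Ideal.Quotient.mk_surjective
    refine exists_sq_add_mul_sq_of_field ?_ (hd.map (Ideal.Quotient.mk I.asIdeal)).ne_zero _
    exact_mod_cast (h2.map (Ideal.Quotient.mk I.asIdeal)).ne_zero
  choose a b hab using key
  let e := IsArtinianRing.quotNilradicalEquivPi A
  obtain ⟨a', ha'⟩ := Ideal.Quotient.mk_surjective (e.symm a)
  obtain ⟨b', hb'⟩ := Ideal.Quotient.mk_surjective (e.symm b)
  have hmk : Ideal.Quotient.mk (nilradical A) v =
      Ideal.Quotient.mk (nilradical A) (a' ^ 2 + d * b' ^ 2) := by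
    apply e.injective
    rw [map_add, map_mul, map_pow, map_pow, ha', hb', map_add, map_mul, map_pow, map_pow,
      e.apply_symm_apply, e.apply_symm_apply]
    exact funext hab
  have hnil : IsNilpotent (v - (a' ^ 2 + d * b' ^ 2)) := by
    rwa [Ideal.Quotient.eq, mem_nilradical] at hmk
  obtain ⟨u, hu⟩ : IsUnit (a' ^ 2 + d * b' ^ 2) := by
    have := hnil.neg.isUnit_add_left_of_commute hv (Commute.all _ _)
    simpa using this
  obtain ⟨r, hr⟩ := exists_sq_eq_one_add_of_isNilpotent h2
    ((Commute.all (↑u⁻¹ : A) _).isNilpotent_mul_left hnil)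
  refine ⟨a' * r, b' * r, ?_⟩
  have h1 : (u : A) * ↑u⁻¹ = 1 := u.mul_inv
  rw [← hu] at hr
  linear_combination (v - u) * (-h1) - (u : A) * hr + r ^ 2 * hu

lemma sm2_sq : sm2 ^ 2 = -2 := by
  rw [sm2, mul_pow, Complex.I_sq, ← Complex.ofReal_pow, Real.sq_sqrt (by norm_num)]
  norm_num

lemma s2D_sq (D : ℕ) : s2D D ^ 2 = 2 * D := by
  rw [s2D, ← Complex.ofReal_pow, Real.sq_sqrt (by positivity)]
  norm_num

lemma s2D_mem_Rpf_one (D : ℕ) : s2D D ∈ Rpf D 1 := by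
  simpa [Rpf] using Subring.subset_closure (s := {((1 : ℕ) : ℂ) * s2D D}) rfl

lemma sm2_mem_Rf (D f : ℕ) : sm2 ∈ Rf D f := Subring.subset_closure (Or.inl rfl)

/-- `R⁺₁ = ℤ + ℤ·√(2D)`. -/
lemma exists_eq_of_mem_Rpf_one {D : ℕ} {x : ℂ} (hx : x ∈ Rpf D 1) :
    ∃ a b : ℤ, x = a + b * s2D D := by
  induction hx using Subring.closure_induction with
  | mem y hy => exact ⟨0, 1, by rcases hy with rfl; simp⟩
  | one => exact ⟨1, 0, by simp⟩
  | zero => exact ⟨0, 0, by simp⟩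
  | add x y _ _ ihx ihy =>
      obtain ⟨a, b, rfl⟩ := ihx
      obtain ⟨c, d, rfl⟩ := ihy
      exact ⟨a + c, b + d, by push_cast; ring⟩
  | neg x _ ihx =>
      obtain ⟨a, b, rfl⟩ := ihx
      exact ⟨-a, -b, by push_cast; ring⟩
  | mul x y _ _ ihx ihy =>
      obtain ⟨a, b, rfl⟩ := ihx
      obtain ⟨c, d, rfl⟩ := ihy
      exact ⟨a * c + 2 * D * b * d, a * d + b * c, by
        push_cast
        linear_combination (b : ℂ) * d * s2D_sq D⟩

/-- `R⁺₁` is fixed by complex conjugation. -/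
lemma conj_eq_of_mem_Rpf_one {D : ℕ} {x : ℂ} (hx : x ∈ Rpf D 1) : (starRingEnd ℂ) x = x := by
  obtain ⟨a, b, rfl⟩ := exists_eq_of_mem_Rpf_one hx
  simp [conj_s2D]

/-- `w` is a root of `X² - √(2D)·X + (D+1)/2`. -/
lemma w_sq {D : ℕ} (hD : Odd D) : w D ^ 2 = s2D D * w D - ((D + 1) / 2 : ℕ) := by
  obtain ⟨k, rfl⟩ := hD
  have h : (2 * k + 1 + 1) / 2 = k + 1 := by omega
  have h1 := s2D_sq (2 * k + 1)
  rw [h, w]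
  push_cast at h1 ⊢
  linear_combination (-1 / 4 : ℂ) * h1 + (1 / 4 : ℂ) * sm2_sq

/-- `R₁ = R⁺₁ + R⁺₁·w`. -/
lemma exists_eq_add_mul_w_of_mem_Rf_one {D : ℕ} (hD : Odd D) {x : ℂ} (hx : x ∈ Rf D 1) :
    ∃ p ∈ Rpf D 1, ∃ q ∈ Rpf D 1, x = p + q * w D := by
  have hs := s2D_mem_Rpf_one D
  induction hx using Subring.closure_induction with
  | mem y hy =>
      rcases hy with rfl | rfl
      · exact ⟨-s2D D, neg_mem hs, 2, ofNat_mem _ 2, by rw [s2D_eq]; ring⟩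
      · exact ⟨0, zero_mem _, 1, one_mem _, by simp⟩
  | one => exact ⟨1, one_mem _, 0, zero_mem _, by simp⟩
  | zero => exact ⟨0, zero_mem _, 0, zero_mem _, by simp⟩
  | add x y _ _ ihx ihy =>
      obtain ⟨p, hp, q, hq, rfl⟩ := ihx
      obtain ⟨p', hp', q', hq', rfl⟩ := ihy
      exact ⟨p + p', add_mem hp hp', q + q', add_mem hq hq', by ring⟩
  | neg x _ ihx =>
      obtain ⟨p, hp, q, hq, rfl⟩ := ihx
      exact ⟨-p, neg_mem hp, -q, neg_mem hq, by ring⟩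
  | mul x y _ _ ihx ihy =>
      obtain ⟨p, hp, q, hq, rfl⟩ := ihx
      obtain ⟨p', hp', q', hq', rfl⟩ := ihy
      exact ⟨p * p' - q * q' * ((D + 1) / 2 : ℕ),
        sub_mem (mul_mem hp hp') (mul_mem (mul_mem hq hq') (natCast_mem _ _)),
        p * q' + q * p' + q * q' * s2D D,
        add_mem (add_mem (mul_mem hp hq') (mul_mem hq hp')) (mul_mem (mul_mem hq hq') hs),
        by linear_combination q * q' * w_sq hD⟩

/-- The trace of `K/K⁺` maps `R₁` into `R⁺₁`. -/
lemma add_conj_mem_Rpf_one {D : ℕ} (hD : Odd D) {x : ℂ} (hx : x ∈ Rf D 1) :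
    x + (starRingEnd ℂ) x ∈ Rpf D 1 := by
  obtain ⟨p, hp, q, hq, rfl⟩ := exists_eq_add_mul_w_of_mem_Rf_one hD hx
  have h : p + q * w D + (starRingEnd ℂ) (p + q * w D) = p + p + q * s2D D := by
    rw [map_add, map_mul, conj_eq_of_mem_Rpf_one hp, conj_eq_of_mem_Rpf_one hq, conj_w, s2D_eq]
    ring
  rw [h]
  exact add_mem (add_mem hp hp) (mul_mem hq (s2D_mem_Rpf_one D))

lemma natCast_quotient_fIdeal (R : Subring ℂ) (f : ℕ) : (f : R ⧸ fIdeal R f) = 0 := by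
  rw [← map_natCast (Ideal.Quotient.mk (fIdeal R f)), Ideal.Quotient.eq_zero_iff_mem]
  exact Ideal.subset_span rfl

/-- An odd integer `f` makes `2` invertible modulo `f`. -/
lemma isUnit_two_quotient_fIdeal (R : Subring ℂ) {f : ℕ} (hf : Odd f) :
    IsUnit (2 : R ⧸ fIdeal R f) := by
  obtain ⟨k, rfl⟩ := hf
  have h := natCast_quotient_fIdeal R (2 * k + 1)
  push_cast at h
  exact IsUnit.of_mul_eq_one (-(k : R ⧸ fIdeal R (2 * k + 1))) (by linear_combination -h)

lemma finite_quotient_Rpf_one (D : ℕ) {f : ℕ} (hf : 0 < f) :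
    Finite (Rpf D 1 ⧸ fIdeal (Rpf D 1) f) := by
  have : NeZero f := ⟨hf.ne'⟩
  let g : ZMod f →+ Rpf D 1 ⧸ fIdeal (Rpf D 1) f :=
    ZMod.lift f ⟨Int.castAddHom _, by simpa using natCast_quotient_fIdeal _ f⟩
  have hg (a : ℤ) : g a = a := ZMod.lift_coe f _ a
  refine Finite.of_surjective (fun p : ZMod f × ZMod f ↦ g p.1 + g p.2 *
    Ideal.Quotient.mk (fIdeal (Rpf D 1) f) ⟨s2D D, s2D_mem_Rpf_one D⟩) fun x ↦ ?_
  obtain ⟨⟨x, hx⟩, rfl⟩ := Ideal.Quotient.mk_surjective x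
  obtain ⟨a, b, rfl⟩ := exists_eq_of_mem_Rpf_one hx
  refine ⟨(a, b), ?_⟩
  simp only [hg]
  rw [← map_intCast (Ideal.Quotient.mk (fIdeal (Rpf D 1) f)),
    ← map_intCast (Ideal.Quotient.mk (fIdeal (Rpf D 1) f)), ← map_mul, ← map_add]
  exact congrArg _ (Subtype.ext (by simp))

lemma coe_subringConj (R : Subring ℂ) (hc : ∀ x ∈ R, (starRingEnd ℂ) x ∈ R) (x : R) :
    (subringConj R hc x : ℂ) = (starRingEnd ℂ) x := rfl

lemma quotIncl_mk {R S : Subring ℂ} (h : R ≤ S) (f : ℕ) (x : R) :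
    quotIncl h f (Ideal.Quotient.mk _ x) = Ideal.Quotient.mk _ (Subring.inclusion h x) :=
  Ideal.quotientMap_mk

lemma quotConj_mk (R : Subring ℂ) (hc : ∀ x ∈ R, (starRingEnd ℂ) x ∈ R) (f : ℕ) (x : R) :
    quotConj R hc f (Ideal.Quotient.mk _ x) = Ideal.Quotient.mk _ (subringConj R hc x) :=
  Ideal.quotientMap_mk

lemma quotIncl_injective {D : ℕ} (hD : Odd D) {f : ℕ} (hf : Odd f) :
    Function.Injective (quotIncl (Rpf_le_Rf D 1) f) := by
  rw [injective_iff_map_eq_zero]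
  intro x hx
  obtain ⟨x, rfl⟩ := Ideal.Quotient.mk_surjective x
  rw [quotIncl_mk, Ideal.Quotient.eq_zero_iff_mem, fIdeal,
    Ideal.mem_span_singleton] at hx
  obtain ⟨y, hy⟩ := hx
  have hxy : (x : ℂ) = f * y := by simpa using congrArg Subtype.val hy
  have hxy' : (x : ℂ) = f * (starRingEnd ℂ) y := by
    rw [← conj_eq_of_mem_Rpf_one x.2, hxy, map_mul, map_natCast]
  rw [Ideal.Quotient.eq_zero_iff_mem, fIdeal, Ideal.mem_span_singleton]
  obtain ⟨k, hk⟩ := hf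
  refine ⟨x - k * ⟨_, add_conj_mem_Rpf_one hD y.2⟩, Subtype.ext ?_⟩
  have hk' : (f : ℂ) = 2 * k + 1 := by exact_mod_cast hk
  push_cast
  linear_combination (-(x : ℂ)) * hk' - (k : ℂ) * hxy - (k : ℂ) * hxy'

lemma quotConj_quotIncl (D f : ℕ) (x : Rpf D 1 ⧸ fIdeal (Rpf D 1) f) :
    quotConj (Rf D 1) (conj_mem_Rf D 1) f (quotIncl (Rpf_le_Rf D 1) f x) =
      quotIncl (Rpf_le_Rf D 1) f x := by
  obtain ⟨x, rfl⟩ := Ideal.Quotient.mk_surjective x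
  have h : subringConj (Rf D 1) (conj_mem_Rf D 1) (Subring.inclusion (Rpf_le_Rf D 1) x) =
      Subring.inclusion (Rpf_le_Rf D 1) x := Subtype.ext (by
    rw [coe_subringConj, Subring.coe_inclusion, conj_eq_of_mem_Rpf_one x.2])
  rw [quotIncl_mk, quotConj_mk, h]

/-- Let `f` be an odd positive integer.  The natural ring map
`R⁺₁/fR⁺₁ → R₁/fR₁` is injective, and the norm map `x ↦ x·x̄` from `(R₁/fR₁)ˣ`
to `(R⁺₁/fR⁺₁)ˣ` is surjective: every unit of `R⁺₁/fR⁺₁` is the norm of a unit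
of `R₁/fR₁` (where we identify `R⁺₁/fR⁺₁` with its image in `R₁/fR₁`). -/
theorem quotient_norm_surjective_on_units (D : ℕ) (hD0 : 0 < D)
    (hDsf : Squarefree D) (hD4 : D % 4 = 1) (f : ℕ) (hf1 : Odd f) (hf0 : 0 < f) :
    Function.Injective (quotIncl (Rpf_le_Rf D 1) f) ∧
    ∀ v : ((Rpf D 1) ⧸ fIdeal (Rpf D 1) f)ˣ,
      ∃ u : ((Rf D 1) ⧸ fIdeal (Rf D 1) f)ˣ,
        Units.map (quotIncl (Rpf_le_Rf D 1) f).toMonoidHom v =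
          u * Units.map (quotConj (Rf D 1) (conj_mem_Rf D 1) f).toMonoidHom u := by
  have hD : Odd D := Nat.odd_iff.2 (by omega)
  refine ⟨quotIncl_injective hD hf1, fun v ↦ ?_⟩
  have := finite_quotient_Rpf_one D hf0
  have h2 := isUnit_two_quotient_fIdeal (Rpf D 1) hf1
  obtain ⟨a, b, hab⟩ := exists_sq_add_mul_sq_of_isUnit h2 h2 v.isUnit
  set ι := quotIncl (Rpf_le_Rf D 1) f
  set c := quotConj (Rf D 1) (conj_mem_Rf D 1) f with hc
  let m : Rf D 1 ⧸ fIdeal (Rf D 1) f := Ideal.Quotient.mk _ ⟨sm2, sm2_mem_Rf D 1⟩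
  have hcm : c m = -m := by
    have h : subringConj (Rf D 1) (conj_mem_Rf D 1) ⟨sm2, sm2_mem_Rf D 1⟩ =
        -⟨sm2, sm2_mem_Rf D 1⟩ :=
      Subtype.ext (by rw [coe_subringConj, conj_sm2]; rfl)
    rw [hc, quotConj_mk, h, map_neg]
  have hm : m ^ 2 = -2 := by
    have h : (⟨sm2, sm2_mem_Rf D 1⟩ : Rf D 1) ^ 2 = -2 := Subtype.ext sm2_sq
    rw [← map_pow, h, map_neg, map_ofNat]
  have hnorm : ι v = (ι a + m * ι b) * c (ι a + m * ι b) := by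
    rw [map_add, map_mul, quotConj_quotIncl, quotConj_quotIncl, hcm, hab, map_add, map_mul,
      map_pow, map_pow, map_ofNat]
    linear_combination ι b ^ 2 * hm
  obtain ⟨u, hu⟩ : IsUnit (ι a + m * ι b) :=
    isUnit_of_mul_isUnit_left (hnorm ▸ v.isUnit.map ι)
  exact ⟨u, Units.ext (by simpa [hu] using hnorm)⟩
end
end

section
/- Call a nonzero finitely generated R_f-submodule 𝔄 of K a Deligne module for R_f, and call two such modules 𝔄, 𝔅 isomorphic if α·𝔄 = 𝔅 for some nonzero α ∈ K. The number of isomorphism classes of Deligne modules 𝔄 whose multiplier ring {x ∈ K : x·𝔄 ⊆ 𝔄} is exactly R_f is equal to #Cl(R_f). -/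
noncomputable section
open Complex Pointwise

/-- A Deligne module for `R_f`: a nonzero finitely generated `R_f`-submodule of `K`. -/
def IsDeligneModule (D f : ℕ) (A : Submodule (Rf D f) ℂ) : Prop :=
  A ≠ ⊥ ∧ A.FG ∧ (A : Set ℂ) ⊆ Kf D

/-- The multiplier ring `{x ∈ K : x·𝔄 ⊆ 𝔄}` of `𝔄` is exactly `R_f`. -/
def HasMultiplierRingRf (D f : ℕ) (A : Submodule (Rf D f) ℂ) : Prop :=
  {x : ℂ | x ∈ Kf D ∧ ∀ a ∈ (A : Set ℂ), x * a ∈ A} = (Rf D f : Set ℂ)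

/-- Two Deligne modules are isomorphic when one is a nonzero `K`-multiple of the other. -/
def DeligneIso (D f : ℕ)
    (A B : {A : Submodule (Rf D f) ℂ // IsDeligneModule D f A ∧ HasMultiplierRingRf D f A}) :
    Prop :=
  ∃ α : ℂ, α ≠ 0 ∧ α ∈ Kf D ∧ ((B : Submodule (Rf D f) ℂ) : Set ℂ) =
    (fun z => α * z) '' ((A : Submodule (Rf D f) ℂ) : Set ℂ)

/-- `ℤ√-2` is a principal ideal ring, by division with remainder for the norm. -/
theorem Zsqrtd.isPrincipalIdealRing_neg_two : IsPrincipalIdealRing (ℤ√(-2)) := by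
  have hdiv (a b : ℤ√(-2)) (hb : b ≠ 0) : ∃ q, (a - b * q).norm < b.norm := by
    have hn : 0 < b.norm := lt_of_le_of_ne (Zsqrtd.norm_nonneg (by norm_num) b)
      (Ne.symm (mt (Zsqrtd.norm_eq_zero_iff (by norm_num) b).1 hb))
    have hround (x : ℤ) : ∃ q : ℤ, 2 * |x - b.norm * q| ≤ b.norm := by
      refine ⟨round ((x : ℚ) / b.norm), ?_⟩
      have hn' : (0 : ℚ) < b.norm := by exact_mod_cast hn
      have h := abs_sub_round ((x : ℚ) / b.norm)
      have h2 : |(x : ℚ) - b.norm * (round ((x : ℚ) / b.norm) : ℤ)| =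
          b.norm * |(x : ℚ) / b.norm - (round ((x : ℚ) / b.norm) : ℤ)| := by
        rw [← abs_of_pos hn', ← abs_mul, abs_of_pos hn', mul_sub, mul_div_cancel₀ _ hn'.ne']
      have h3 : 2 * |(x : ℚ) - b.norm * (round ((x : ℚ) / b.norm) : ℤ)| ≤ b.norm := by
        rw [h2]; nlinarith
      exact_mod_cast h3
    obtain ⟨q₁, h₁⟩ := hround (a * star b).re
    obtain ⟨q₂, h₂⟩ := hround (a * star b).im
    refine ⟨⟨q₁, q₂⟩, lt_of_mul_lt_mul_right ?_ hn.le⟩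
    have key : (a - b * ⟨q₁, q₂⟩) * star b
        = ⟨(a * star b).re - b.norm * q₁, (a * star b).im - b.norm * q₂⟩ := by
      ext <;> simp [Zsqrtd.norm_def] <;> ring
    have hnorm := congrArg Zsqrtd.norm key
    rw [Zsqrtd.norm_mul, Zsqrtd.norm_conj,
      Zsqrtd.norm_def ⟨(a * star b).re - b.norm * q₁, _⟩] at hnorm
    rw [hnorm]
    dsimp only
    have e₁ := mul_self_le_mul_self (by positivity) h₁
    have e₂ := mul_self_le_mul_self (by positivity) h₂
    have s₁ := abs_mul_abs_self ((a * star b).re - b.norm * q₁)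
    have s₂ := abs_mul_abs_self ((a * star b).im - b.norm * q₂)
    nlinarith [mul_pos hn hn]
  refine ⟨fun I => ?_⟩
  by_cases hI : I = ⊥
  · exact hI ▸ bot_isPrincipal
  obtain ⟨x, hx, hx0⟩ := Submodule.exists_mem_ne_zero_of_ne_bot hI
  have hex : ∃ n : ℕ, ∃ y ∈ I, y ≠ 0 ∧ y.norm.natAbs = n := ⟨_, x, hx, hx0, rfl⟩
  classical
  obtain ⟨y, hy, hy0, hyn⟩ := Nat.find_spec hex
  refine ⟨y, _root_.le_antisymm (fun z hz => ?_) ((Submodule.span_singleton_le_iff_mem _ _).2 hy)⟩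
  obtain ⟨q, hq⟩ := hdiv z y hy0
  have hr : z - y * q = 0 := by
    by_contra hr
    refine Nat.find_min hex ?_ ⟨z - y * q, I.sub_mem hz (I.mul_mem_right _ hy), hr, rfl⟩
    have := Zsqrtd.norm_nonneg (by norm_num : (-2 : ℤ) ≤ 0) (z - y * q)
    omega
  exact Ideal.mem_span_singleton.2 ⟨q, sub_eq_zero.1 hr⟩

/-- Let `R = φ(O) + φ(O) θ` be a quadratic extension of a principal ideal ring `O`. A nonzero ideal
of `R` whose multiplier ring is `R` has a multiple that is a nonzero principal ideal. -/
theorem Ideal.exists_mul_eq_span_singleton_of_quadratic {O R : Type*} [CommRing O]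
    [IsPrincipalIdealRing O] [CommRing R] [IsDomain R] (φ : O →+* R) {θ : R} {B C : O}
    (hθ : θ ^ 2 = φ B * θ + φ C) (hspan : ∀ x : R, ∃ a b, x = φ a + φ b * θ)
    (hconj : ∀ a b, φ a + φ b * (φ B - θ) = 0 → φ a + φ b * θ = 0)
    {I : Ideal R} (hI : I ≠ ⊥)
    (hmul : ∀ x y : R, y ≠ 0 → (∀ a ∈ I, ∃ b ∈ I, x * a = y * b) → y ∣ x) :
    ∃ (J : Ideal R) (g : R), g ≠ 0 ∧ I * J = Ideal.span {g} := by
  let I₀ : Ideal O := I.comap φ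
  let I₁ : Ideal O :=
    { carrier := {b | ∃ a, φ a + φ b * θ ∈ I}
      zero_mem' := ⟨0, by simp⟩
      add_mem' := by
        rintro b b' ⟨a, ha⟩ ⟨a', ha'⟩
        refine ⟨a + a', ?_⟩
        convert! I.add_mem ha ha' using 1
        simp only [map_add]; ring
      smul_mem' := by
        rintro c b ⟨a, ha⟩
        refine ⟨c * a, ?_⟩
        convert! I.mul_mem_left (φ c) ha using 1
        simp only [map_mul, smul_eq_mul]; ring }
  obtain ⟨u, hu⟩ := IsPrincipalIdealRing.principal I₀
  obtain ⟨v₁, hv₁⟩ := IsPrincipalIdealRing.principal I₁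
  have huI : φ u ∈ I := (hu ▸ Ideal.mem_span_singleton_self u : u ∈ I₀)
  obtain ⟨v₀, hvI⟩ := (hv₁ ▸ Ideal.mem_span_singleton_self v₁ : v₁ ∈ I₁)
  set v := φ v₀ + φ v₁ * θ with hv
  set v' := φ v₀ + φ v₁ * (φ B - θ) with hv'
  have hIspan : I = Ideal.span {φ u, v} := by
    refine le_antisymm (fun x hx => ?_) (Ideal.span_le.2 (by rintro _ (rfl | rfl) <;> assumption))
    obtain ⟨a, b, rfl⟩ := hspan x
    have hb : b ∈ I₁ := ⟨a, hx⟩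
    rw [hv₁] at hb
    obtain ⟨c, rfl⟩ := Ideal.mem_span_singleton.1 hb
    have ha : a - c * v₀ ∈ I₀ := by
      change φ _ ∈ I
      convert! I.sub_mem hx (I.mul_mem_left (φ c) hvI) using 1
      simp only [map_sub, map_mul, hv]; ring
    rw [hu] at ha
    obtain ⟨d, hd⟩ := Ideal.mem_span_singleton.1 ha
    refine Ideal.mem_span_pair.2 ⟨φ d, φ c, ?_⟩
    have := congrArg φ hd
    simp only [map_sub, map_mul] at this ⊢
    rw [hv]; linear_combination -this
  have hu0 : φ u ≠ 0 := by
    obtain ⟨x, hx, hx0⟩ := Submodule.exists_mem_ne_zero_of_ne_bot hI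
    obtain ⟨a, b, rfl⟩ := hspan x
    have hN : a * a + a * b * B - b * b * C ∈ I₀ := by
      change φ _ ∈ I
      convert! I.mul_mem_right (φ a + φ b * (φ B - θ)) hx using 1
      simp only [map_sub, map_add, map_mul]
      linear_combination φ b * φ b * hθ
    rw [hu] at hN
    obtain ⟨d, hd⟩ := Ideal.mem_span_singleton.1 hN
    intro h0
    have h := congrArg φ hd
    simp only [map_sub, map_add, map_mul, h0, zero_mul] at h
    have : (φ a + φ b * θ) * (φ a + φ b * (φ B - θ)) = 0 := by
      linear_combination h - φ b * φ b * hθ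
    rcases mul_eq_zero.1 this with h | h
    · exact hx0 h
    · exact hx0 (hconj _ _ h)
  set P := u * u with hP
  set T := u * (v₀ + v₀ + v₁ * B) with hT
  set Q := v₀ * v₀ + v₀ * v₁ * B - v₁ * v₁ * C with hQ
  have hTφ : φ T = φ u * v + φ u * v' := by
    simp only [hT, hv, hv', map_add, map_mul]; ring
  have hQφ : φ Q = v * v' := by
    simp only [hQ, hv, hv', map_sub, map_add, map_mul]; linear_combination φ v₁ * φ v₁ * hθ
  have hPφ : φ P = φ u * φ u := map_mul _ _ _
  obtain ⟨g, hg⟩ := IsPrincipalIdealRing.principal (Ideal.span {P, T, Q})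
  change _ = Ideal.span {g} at hg
  have hdvd (x : O) (hx : x ∈ ({P, T, Q} : Set O)) : ∃ y, x = g * y :=
    Ideal.mem_span_singleton.1 (hg ▸ Ideal.subset_span hx)
  obtain ⟨p, hp⟩ := hdvd P (by simp)
  obtain ⟨t, ht⟩ := hdvd T (by simp)
  obtain ⟨q, hq⟩ := hdvd Q (by simp)
  have hgmem : g ∈ Ideal.span {P, T, Q} := hg ▸ Ideal.mem_span_singleton_self g
  obtain ⟨x, z, hz, hxz⟩ := Ideal.mem_span_insert.1 hgmem
  obtain ⟨y, z, rfl⟩ := Ideal.mem_span_pair.1 hz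
  have hp' : φ u * φ u = φ g * φ p := by rw [← hPφ, hp, map_mul]
  have ht' : φ u * v + φ u * v' = φ g * φ t := by rw [← hTφ, ht, map_mul]
  have hq' : v * v' = φ g * φ q := by rw [← hQφ, hq, map_mul]
  have hxz' : φ g = φ x * (φ u * φ u) + (φ y * (φ u * v + φ u * v') + φ z * (v * v')) := by
    rw [hxz]; simp only [map_add, map_mul, hPφ, hTφ, hQφ]
  have hg0 : φ g ≠ 0 := by
    rintro h0
    rw [h0, zero_mul] at hp'
    exact hu0 (mul_self_eq_zero.1 hp')
  obtain ⟨m, hm⟩ : φ g ∣ φ u * v := by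
    refine hmul _ _ hg0 fun a ha => ?_
    rw [hIspan] at ha
    obtain ⟨c, d, rfl⟩ := Ideal.mem_span_pair.1 ha
    refine ⟨c * (φ p * v) + d * (φ t * v - φ q * φ u), ?_, ?_⟩
    · exact I.add_mem (I.mul_mem_left _ (I.mul_mem_left _ hvI)) (I.mul_mem_left _
        (I.sub_mem (I.mul_mem_left _ hvI) (I.mul_mem_left _ huI)))
    · linear_combination c * v * hp' + d * v * ht' - d * φ u * hq'
  refine ⟨Ideal.span {φ u, v'}, φ g, hg0, ?_⟩
  rw [hIspan, Ideal.span_pair_mul_span_pair]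
  apply le_antisymm
  · rw [Ideal.span_le]
    rintro _ (rfl | rfl | rfl | rfl) <;> rw [SetLike.mem_coe, Ideal.mem_span_singleton]
    · exact ⟨_, hp'⟩
    · exact ⟨φ t - m, by linear_combination ht' - hm⟩
    · exact ⟨m, by linear_combination hm⟩
    · exact ⟨_, hq'⟩
  · rw [Ideal.span_le, Set.singleton_subset_iff, SetLike.mem_coe, hxz']
    have hs {r : R} (hr : r ∈ ({φ u * φ u, φ u * v', v * φ u, v * v'} : Set R)) :
        r ∈ Ideal.span {φ u * φ u, φ u * v', v * φ u, v * v'} := Ideal.subset_span hr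
    refine add_mem (Ideal.mul_mem_left _ _ (hs (by simp))) (add_mem (Ideal.mul_mem_left _ _
      (add_mem ?_ (hs (by simp)))) (Ideal.mul_mem_left _ _ (hs (by simp))))
    rw [mul_comm (φ u) v]; exact hs (by simp)

open scoped nonZeroDivisors in
/-- A nonzero fractional ideal with multiplier ring `R` is invertible when `R` is a quadratic
extension of a principal ideal ring. -/
theorem FractionalIdeal.isUnit_of_quadratic {O R K : Type*} [CommRing O]
    [IsPrincipalIdealRing O] [CommRing R] [IsDomain R] [Field K] [Algebra R K] [IsFractionRing R K]
    (φ : O →+* R) {θ : R} {B C : O}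
    (hθ : θ ^ 2 = φ B * θ + φ C) (hspan : ∀ x : R, ∃ a b, x = φ a + φ b * θ)
    (hconj : ∀ a b, φ a + φ b * (φ B - θ) = 0 → φ a + φ b * θ = 0)
    {A : FractionalIdeal R⁰ K} (hA : A ≠ 0)
    (hmul : ∀ x : K, (∀ a ∈ A, x * a ∈ A) → ∃ r, algebraMap R K r = x) : IsUnit A := by
  obtain ⟨d, I, hd, rfl⟩ := FractionalIdeal.exists_eq_spanSingleton_mul A
  have hd' : algebraMap R K d ≠ 0 := by simpa using hd
  obtain ⟨J, g, hg, hIJ⟩ := Ideal.exists_mul_eq_span_singleton_of_quadratic φ hθ hspan hconj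
    (I := I) (by rintro rfl; simp at hA) (fun x y hy h => by
      have hy' : algebraMap R K y ≠ 0 := by simpa using hy
      obtain ⟨r, hr⟩ := hmul (algebraMap R K x / algebraMap R K y) (fun a ha => by
        obtain ⟨_, ha', rfl⟩ := FractionalIdeal.mem_singleton_mul.1 ha
        obtain ⟨c, hc, rfl⟩ := (FractionalIdeal.mem_coeIdeal _).1 ha'
        obtain ⟨b, hb, hab⟩ := h c hc
        refine FractionalIdeal.mem_singleton_mul.2
          ⟨_, (FractionalIdeal.mem_coeIdeal _).2 ⟨b, hb, rfl⟩, ?_⟩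
        have := congrArg (algebraMap R K) hab
        rw [map_mul, map_mul] at this
        field_simp
        exact this)
      refine ⟨r, IsFractionRing.injective R K ?_⟩
      rw [map_mul, hr, mul_div_cancel₀ _ hy'])
  have hsing {x : K} (hx : x ≠ 0) : IsUnit (FractionalIdeal.spanSingleton R⁰ x) :=
    IsUnit.of_mul_eq_one (FractionalIdeal.spanSingleton R⁰ x⁻¹) (by
      rw [FractionalIdeal.spanSingleton_mul_spanSingleton, mul_inv_cancel₀ hx,
        FractionalIdeal.spanSingleton_one])
  refine (hsing (inv_ne_zero hd')).mul
    (isUnit_of_mul_isUnit_left (y := (J : FractionalIdeal R⁰ K)) ?_)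
  rw [← FractionalIdeal.coeIdeal_mul, hIJ, FractionalIdeal.coeIdeal_span_singleton]
  exact hsing (by simpa using hg)

theorem sm2_mul_sm2 : sm2 * sm2 = -2 := by
  have h : ((Real.sqrt 2 : ℝ) : ℂ) * (Real.sqrt 2 : ℝ) = 2 := by
    rw [← Complex.ofReal_mul, Real.mul_self_sqrt (by norm_num)]; norm_num
  rw [sm2]; linear_combination (Complex.I * Complex.I) * h + 2 * Complex.I_mul_I

theorem s2D_mul_s2D (D : ℕ) : s2D D * s2D D = 2 * D := by
  rw [s2D, ← Complex.ofReal_mul, Real.mul_self_sqrt (by positivity)]; norm_num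

theorem smD_eq (D : ℕ) : smD D = sm2 * w D + 1 := by
  have h : s2D D = (Real.sqrt 2 : ℝ) * (Real.sqrt D : ℝ) := by
    rw [s2D, Real.sqrt_mul (by norm_num), Complex.ofReal_mul]
  have h2 : ((Real.sqrt 2 : ℝ) : ℂ) * (Real.sqrt 2 : ℝ) = 2 := by
    rw [← Complex.ofReal_mul, Real.mul_self_sqrt (by norm_num)]; norm_num
  rw [w, h, mul_div_assoc', mul_add, sm2_mul_sm2, sm2, smD]
  linear_combination -(Complex.I * (Real.sqrt D : ℝ) / 2) * h2

theorem two_mul_w_sq (D : ℕ) : 2 * w D ^ 2 = 2 * (sm2 * w D) + (D + 1) := by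
  rw [w]; linear_combination s2D_mul_s2D D / 2 - sm2_mul_sm2 / 2

theorem irrational_sqrt_two_mul {D : ℕ} (hD : Odd D) : Irrational (Real.sqrt (2 * D)) := by
  have h : Irrational (Real.sqrt ((2 * D : ℕ) : ℝ)) := by
    rw [irrational_sqrt_natCast_iff]
    rintro ⟨r, hr⟩
    have h2 : 2 ∣ r := by
      have : 2 ∣ r * r := ⟨D, hr.symm⟩
      rcases Nat.prime_two.dvd_mul.1 this with h | h <;> exact h
    obtain ⟨k, rfl⟩ := h2
    obtain ⟨m, rfl⟩ := hD
    have : 2 * m + 1 = 2 * (k * k) := by linarith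
    omega
  simpa using h

/-- The root `√-2` in `R_f`. -/
def Rf.root (D f : ℕ) : Rf D f := ⟨sm2, Subring.subset_closure (by simp)⟩

/-- The element `f·w` of `R_f`. -/
def Rf.gen (D f : ℕ) : Rf D f := ⟨f * w D, Subring.subset_closure (by simp)⟩

/-- The inclusion of `ℤ√-2` into `R_f`. -/
def Rf.ofZsqrtd (D f : ℕ) : ℤ√(-2) →+* Rf D f :=
  Zsqrtd.lift ⟨Rf.root D f, Subtype.ext (by push_cast; exact sm2_mul_sm2)⟩

theorem Rf.coe_ofZsqrtd (D f : ℕ) (a : ℤ√(-2)) :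
    (Rf.ofZsqrtd D f a : ℂ) = a.re + a.im * sm2 := by
  simp [Rf.ofZsqrtd, Rf.root]

theorem Rf.gen_sq {D : ℕ} (hD : Odd D) (f : ℕ) : Rf.gen D f ^ 2 =
    Rf.ofZsqrtd D f ⟨0, f⟩ * Rf.gen D f + Rf.ofZsqrtd D f ⟨f ^ 2 * ((D + 1) / 2 : ℕ), 0⟩ := by
  obtain ⟨m, rfl⟩ := hD
  have h := two_mul_w_sq (2 * m + 1)
  have hm : (2 * m + 1 + 1) / 2 = m + 1 := by omega
  apply Subtype.ext
  simp only [Subring.coe_add, Subring.coe_mul, SubmonoidClass.coe_pow, Rf.coe_ofZsqrtd, Rf.gen, hm]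
  push_cast at h ⊢
  linear_combination (f : ℂ) ^ 2 / 2 * h

theorem Rf.exists_eq_add_mul_gen {D : ℕ} (hD : Odd D) (f : ℕ) (x : Rf D f) :
    ∃ a b, x = Rf.ofZsqrtd D f a + Rf.ofZsqrtd D f b * Rf.gen D f := by
  obtain ⟨x, hx⟩ := x
  induction hx using Subring.closure_induction with
  | mem x hx =>
    rcases hx with rfl | rfl
    · exact ⟨⟨0, 1⟩, 0, Subtype.ext (by simp [Rf.coe_ofZsqrtd])⟩
    · exact ⟨0, 1, Subtype.ext (by simp [Rf.gen])⟩
  | zero => exact ⟨0, 0, Subtype.ext (by simp)⟩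
  | one => exact ⟨1, 0, Subtype.ext (by simp)⟩
  | add x y hx hy ihx ihy =>
    obtain ⟨a, b, h⟩ := ihx
    obtain ⟨a', b', h'⟩ := ihy
    refine ⟨a + a', b + b', ?_⟩
    change (⟨x, hx⟩ : Rf D f) + ⟨y, hy⟩ = _
    rw [h, h', map_add, map_add]; ring
  | neg x hx ih =>
    obtain ⟨a, b, h⟩ := ih
    refine ⟨-a, -b, ?_⟩
    change -(⟨x, hx⟩ : Rf D f) = _
    rw [h, map_neg, map_neg]; ring
  | mul x y hx hy ihx ihy =>
    obtain ⟨a, b, h⟩ := ihx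
    obtain ⟨a', b', h'⟩ := ihy
    refine ⟨a * a' + b * b' * ⟨f ^ 2 * ((D + 1) / 2 : ℕ), 0⟩,
      a * b' + b * a' + b * b' * ⟨0, f⟩, ?_⟩
    change (⟨x, hx⟩ : Rf D f) * ⟨y, hy⟩ = _
    rw [h, h']
    simp only [map_add, map_mul]
    linear_combination Rf.ofZsqrtd D f b * Rf.ofZsqrtd D f b' * Rf.gen_sq hD f

theorem Rf.eq_zero_of_conj_eq_zero {D : ℕ} (hD : Odd D) {f : ℕ} (hf : 0 < f) (a b : ℤ√(-2))
    (h : Rf.ofZsqrtd D f a + Rf.ofZsqrtd D f b * (Rf.ofZsqrtd D f ⟨0, f⟩ - Rf.gen D f) = 0) :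
    Rf.ofZsqrtd D f a + Rf.ofZsqrtd D f b * Rf.gen D f = 0 := by
  have hb : b = 0 := by
    have hf' : (f : ℤ) ≠ 0 := by exact_mod_cast hf.ne'
    have h0 (m n : ℤ) (h : (m : ℝ) + n * f * Real.sqrt (2 * D) = 0) : n = 0 := by
      by_contra hn
      have hnf : n * (f : ℤ) ≠ 0 := mul_ne_zero hn hf'
      refine ((irrational_sqrt_two_mul hD).intCast_mul hnf).ne_int (-m) ?_
      push_cast; linarith
    have h := congrArg Subtype.val h
    simp only [Subring.coe_add, Subring.coe_mul, AddSubgroupClass.coe_sub, Subring.coe_zero,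
      Rf.coe_ofZsqrtd, Rf.gen, w, s2D, sm2] at h
    generalize Real.sqrt (2 * D) = r at h h0
    have h2 : (0 : ℝ) < Real.sqrt 2 := by positivity
    have h22 : Real.sqrt 2 * Real.sqrt 2 = 2 := Real.mul_self_sqrt (by norm_num)
    have hre := congrArg Complex.re h
    have him := congrArg Complex.im h
    simp at hre him
    have e₁ : b.re = 0 := neg_eq_zero.1 <| h0 (2 * a.re - 2 * b.im * f) (-b.re) (by
      push_cast; linear_combination 2 * hre + b.im * f * h22)
    have e₂ : b.im = 0 := neg_eq_zero.1 <| h0 (2 * a.im + b.re * f) (-b.im) (by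
      push_cast
      refine mul_left_cancel₀ h2.ne' ?_
      linear_combination 2 * him)
    exact Zsqrtd.ext e₁ e₂
  subst hb
  simpa using h

theorem sm2_mem_Kf (D : ℕ) : sm2 ∈ Kf D := IntermediateField.subset_adjoin _ _ (by simp)

theorem w_mem_Kf (D : ℕ) : w D ∈ Kf D := by
  have h0 : sm2 ≠ 0 := fun h => by simpa [h] using sm2_mul_sm2
  have h : w D = (smD D - 1) / sm2 := by
    rw [smD_eq, add_sub_cancel_right, mul_div_cancel_left₀ _ h0]
  rw [h]
  exact div_mem (sub_mem (IntermediateField.subset_adjoin _ _ (by simp)) (one_mem _)) (sm2_mem_Kf D)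

theorem Rf_le_Kf (D f : ℕ) : Rf D f ≤ (Kf D).toSubring := by
  rw [Rf, Subring.closure_le]
  rintro _ (rfl | rfl)
  · exact sm2_mem_Kf D
  · exact mul_mem (natCast_mem _ f) (w_mem_Kf D)

instance algebraRfKf (D f : ℕ) : Algebra (Rf D f) (Kf D) := (Subring.inclusion (Rf_le_Kf D f)).toAlgebra

theorem exists_eq_div_of_mem_Kf {D f : ℕ} (hf : 0 < f) {z : ℂ} (hz : z ∈ Kf D) :
    ∃ x y : Rf D f, (y : ℂ) ≠ 0 ∧ z = x / y := by
  induction hz using IntermediateField.adjoin_induction with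
  | mem x hx =>
    rcases hx with rfl | rfl
    · exact ⟨Rf.root D f, 1, by simp, by simp [Rf.root]⟩
    · have hf' : (f : ℂ) ≠ 0 := by exact_mod_cast hf.ne'
      refine ⟨Rf.root D f * Rf.gen D f + f, f, by simpa using hf', ?_⟩
      simp only [Rf.root, Rf.gen, Subring.coe_add, Subring.coe_mul, SubringClass.coe_natCast,
        smD_eq]
      field_simp
  | algebraMap q =>
    refine ⟨q.num, q.den, by simp, ?_⟩
    simpa using Rat.cast_def (K := ℂ) q
  | add x y _ _ ihx ihy =>
    obtain ⟨a, b, hb, rfl⟩ := ihx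
    obtain ⟨c, d, hd, rfl⟩ := ihy
    exact ⟨a * d + b * c, b * d, by simpa using mul_ne_zero hb hd, by simp [div_add_div _ _ hb hd]⟩
  | inv x _ ih =>
    obtain ⟨a, b, hb, rfl⟩ := ih
    by_cases ha : (a : ℂ) = 0
    · exact ⟨0, 1, by simp, by simp [ha]⟩
    · exact ⟨b, a, ha, by simp⟩
  | mul x y _ _ ihx ihy =>
    obtain ⟨a, b, hb, rfl⟩ := ihx
    obtain ⟨c, d, hd, rfl⟩ := ihy
    exact ⟨a * c, b * d, by simpa using mul_ne_zero hb hd, by simp [div_mul_div_comm]⟩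

theorem isFractionRing_Rf_Kf {D f : ℕ} (hf : 0 < f) : IsFractionRing (Rf D f) (Kf D) := by
  have : FaithfulSMul (Rf D f) (Kf D) := (faithfulSMul_iff_algebraMap_injective _ _).2
    fun _ _ h => Subtype.ext (congrArg (Subtype.val : Kf D → ℂ) h)
  refine IsFractionRing.of_field _ _ fun z => ?_
  obtain ⟨x, y, -, h⟩ := exists_eq_div_of_mem_Kf (f := f) hf z.2
  exact ⟨x, y, Subtype.ext h⟩

/-- The inclusion of `K` into `ℂ`, as an `R_f`-linear map. -/
def Kf.incl (D f : ℕ) : Kf D →ₗ[Rf D f] ℂ where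
  toFun := Subtype.val
  map_add' _ _ := rfl
  map_smul' _ _ := rfl

theorem Kf.incl_injective (D f : ℕ) : Function.Injective (Kf.incl D f) := Subtype.val_injective

open scoped nonZeroDivisors

theorem isDeligneModule_map_of_isUnit {D f : ℕ} [IsFractionRing (Rf D f) (Kf D)]
    (I : (FractionalIdeal (Rf D f)⁰ (Kf D))ˣ) :
    IsDeligneModule D f ((I : Submodule (Rf D f) (Kf D)).map (Kf.incl D f)) := by
  refine ⟨?_, (FractionalIdeal.fg_unit I).map _, ?_⟩
  · rw [Ne, (Submodule.map_injective_of_injective (Kf.incl_injective D f)).eq_iff'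
      (Submodule.map_bot _),
      FractionalIdeal.coeToSubmodule_eq_bot]
    exact I.ne_zero
  · rintro _ ⟨x, -, rfl⟩
    exact x.2

theorem hasMultiplierRingRf_map_of_isUnit {D f : ℕ} [IsFractionRing (Rf D f) (Kf D)]
    (I : (FractionalIdeal (Rf D f)⁰ (Kf D))ˣ) :
    HasMultiplierRingRf D f ((I : Submodule (Rf D f) (Kf D)).map (Kf.incl D f)) := by
  ext x
  constructor
  · rintro ⟨hxK, hx⟩
    have hle : FractionalIdeal.spanSingleton (Rf D f)⁰ (⟨x, hxK⟩ : Kf D) * I ≤ I := by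
      intro y hy
      obtain ⟨a, ha, rfl⟩ := FractionalIdeal.mem_singleton_mul.1 hy
      obtain ⟨b, hb, hab⟩ := hx a ⟨a, ha, rfl⟩
      rwa [show (⟨x, hxK⟩ : Kf D) * a = b from Subtype.ext hab.symm]
    have hle' := mul_le_mul_left hle (I⁻¹ : (FractionalIdeal (Rf D f)⁰ (Kf D))ˣ).val
    rw [mul_assoc, Units.mul_inv, mul_one, FractionalIdeal.spanSingleton_le_iff_mem] at hle'
    obtain ⟨r, hr⟩ := (FractionalIdeal.mem_one_iff _).1 hle'
    rw [← show (r : ℂ) = x from congrArg Subtype.val hr]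
    exact r.2
  · intro hx
    refine ⟨Rf_le_Kf D f hx, fun a ha => ?_⟩
    exact Submodule.smul_mem _ (⟨x, hx⟩ : Rf D f) ha

/-- An invertible fractional ideal of `R_f`, viewed as a Deligne module. -/
def deligneOfUnit {D f : ℕ} [IsFractionRing (Rf D f) (Kf D)]
    (I : (FractionalIdeal (Rf D f)⁰ (Kf D))ˣ) :
    {A : Submodule (Rf D f) ℂ // IsDeligneModule D f A ∧ HasMultiplierRingRf D f A} :=
  ⟨_, isDeligneModule_map_of_isUnit I, hasMultiplierRingRf_map_of_isUnit I⟩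

theorem deligneOfUnit_injective {D f : ℕ} [IsFractionRing (Rf D f) (Kf D)] :
    Function.Injective (deligneOfUnit (D := D) (f := f)) := fun _ _ h =>
  Units.ext (FractionalIdeal.coeToSubmodule_injective
    (Submodule.map_injective_of_injective (Kf.incl_injective D f) (congrArg Subtype.val h)))

theorem deligneOfUnit_surjective {D f : ℕ} (hD : Odd D) (hf : 0 < f)
    [IsFractionRing (Rf D f) (Kf D)] : Function.Surjective (deligneOfUnit (D := D) (f := f)) := by
  rintro ⟨A, ⟨hA0, hfg, hAK⟩, hmul⟩
  have := Zsqrtd.isPrincipalIdealRing_neg_two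
  have hmap : (A.comap (Kf.incl D f)).map (Kf.incl D f) = A :=
    Submodule.map_comap_eq_of_le fun x hx => ⟨⟨x, hAK hx⟩, rfl⟩
  have hfg' : (A.comap (Kf.incl D f)).FG :=
    Submodule.fg_of_fg_map_injective _ (Kf.incl_injective D f) (hmap.symm ▸ hfg)
  let I : FractionalIdeal (Rf D f)⁰ (Kf D) := ⟨_, FractionalIdeal.isFractional_of_fg hfg'⟩
  have hI : IsUnit I := by
    refine FractionalIdeal.isUnit_of_quadratic (Rf.ofZsqrtd D f) (Rf.gen_sq hD f)
      (Rf.exists_eq_add_mul_gen hD f) (Rf.eq_zero_of_conj_eq_zero hD hf) ?_ fun x hx => ?_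
    · intro h
      refine hA0 ?_
      rw [← hmap, (Submodule.map_injective_of_injective (Kf.incl_injective D f)).eq_iff'
        (Submodule.map_bot _)]
      exact FractionalIdeal.coeToSubmodule_eq_bot.2 h
    · have hxR : (x : ℂ) ∈ (Rf D f : Set ℂ) := by
        rw [← hmul]
        exact ⟨x.2, fun a ha => hx ⟨a, hAK ha⟩ ha⟩
      exact ⟨⟨x, hxR⟩, rfl⟩
  exact ⟨hI.unit, Subtype.ext hmap⟩

theorem deligneIso_deligneOfUnit_iff {D f : ℕ} [IsFractionRing (Rf D f) (Kf D)]
    (I J : (FractionalIdeal (Rf D f)⁰ (Kf D))ˣ) :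
    DeligneIso D f (deligneOfUnit I) (deligneOfUnit J) ↔
      I⁻¹ * J ∈ (toPrincipalIdeal (Rf D f) (Kf D)).range := by
  have key (α : Kf D) : (((deligneOfUnit J : Submodule (Rf D f) ℂ) : Set ℂ) =
      (fun z => (α : ℂ) * z) '' ((deligneOfUnit I : Submodule (Rf D f) ℂ) : Set ℂ)) ↔
      (J : FractionalIdeal (Rf D f)⁰ (Kf D)) =
        FractionalIdeal.spanSingleton (Rf D f)⁰ α * I := by
    have him : (fun z => (α : ℂ) * z) '' ((deligneOfUnit I : Submodule (Rf D f) ℂ) : Set ℂ) =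
        Subtype.val '' {y : Kf D | y ∈ FractionalIdeal.spanSingleton (Rf D f)⁰ α *
          (I : FractionalIdeal (Rf D f)⁰ (Kf D))} := by
      ext z
      constructor
      · rintro ⟨_, ⟨a, ha, rfl⟩, rfl⟩
        exact ⟨α * a, FractionalIdeal.mem_singleton_mul.2 ⟨a, ha, rfl⟩, rfl⟩
      · rintro ⟨_, hy, rfl⟩
        obtain ⟨a, ha, rfl⟩ := FractionalIdeal.mem_singleton_mul.1 hy
        exact ⟨_, ⟨a, ha, rfl⟩, rfl⟩
    rw [him]
    change Subtype.val '' {y : Kf D | y ∈ (J : FractionalIdeal (Rf D f)⁰ (Kf D))} = _ ↔ _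
    rw [Set.image_eq_image Subtype.val_injective]
    exact ⟨fun h => SetLike.ext fun x => Set.ext_iff.1 h x, fun h => by rw [h]⟩
  rw [MonoidHom.mem_range]
  simp only [toPrincipalIdeal_eq_iff]
  have hmul (α : Kf D) : FractionalIdeal.spanSingleton (Rf D f)⁰ α =
      ((I⁻¹ * J : (FractionalIdeal (Rf D f)⁰ (Kf D))ˣ) : FractionalIdeal (Rf D f)⁰ (Kf D)) ↔
      (J : FractionalIdeal (Rf D f)⁰ (Kf D)) =
        FractionalIdeal.spanSingleton (Rf D f)⁰ α * I := by
    rw [Units.val_mul, mul_comm, Units.eq_mul_inv_iff_mul_eq, eq_comm]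
  constructor
  · rintro ⟨α, hα0, hαK, h⟩
    refine ⟨Units.mk0 ⟨α, hαK⟩ fun h => hα0 (congrArg Subtype.val h), (hmul _).2 ?_⟩
    exact (key ⟨α, hαK⟩).1 h
  · rintro ⟨α, h⟩
    refine ⟨α, fun h => α.ne_zero (Subtype.ext h), α.val.2, (key _).2 ((hmul _).1 h)⟩

/-- The number of isomorphism classes of Deligne modules whose multiplier ring is
exactly `R_f` equals `#Cl(R_f)`. -/
theorem card_deligne_modules_eq_card_classGroup (D : ℕ) (hD0 : 0 < D)
    (hDsf : Squarefree D) (hD4 : D % 4 = 1) (f : ℕ) (hf1 : Odd f) (hf0 : 0 < f) :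
    Nat.card (Quot (DeligneIso D f)) = Nat.card (ClassGroup (Rf D f)) := by
  have := isFractionRing_Rf_Kf (D := D) hf0
  have hD : Odd D := Nat.odd_iff.2 (by omega)
  let e := Equiv.ofBijective (deligneOfUnit (D := D) (f := f))
    ⟨deligneOfUnit_injective, deligneOfUnit_surjective hD hf0⟩
  refine Nat.card_congr (Equiv.trans (Equiv.symm ?_) (ClassGroup.equiv (Kf D)).toEquiv.symm)
  exact Quot.congr e fun I J =>
    QuotientGroup.leftRel_apply.trans (deligneIso_deligneOfUnit_iff I J).symm
end
end
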